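/- arXiv:2603.12879 — 4 statements merged into one kernel-verified Lean document; each statement's English description precedes it below -/
import Mathlib

section
/- Let p be a prime, d ≥ 1, R = ℤ/p^dℤ, and let G = ℤ/p^{d₁}ℤ × ⋯ × ℤ/p^{d_r}ℤ be a finite abelian p-group with d ≥ d₁ ≥ ⋯ ≥ d_r ≥ 1, equipped with the standard nondegenerate R-bilinear pairing g·h = Σ_i p^{d−d_i} g_i h_i ∈ R. For each n, define the trivial part G_tr ⊆ (G × G)^n according to the model: (non-symmetric) G_tr = {((g_k,h_k))_{k=1}^n : g_k·h_l = 0 for all k,l ∈ [n]}; (symmetric) G_tr = {((g_k,h_k))_k : g_k·h_k = 0 for all k, and g_k·h_l + g_l·h_k = 0 for all k < l}; (alternating) G_tr = {((g_k,h_k))_k : g_k·h_l − g_l·h_k = 0 for all k < l}. Then lim_{n→∞} |G_tr|/|G|^n equals: the number of subgroups of G in the non-symmetric case; Σ_{H ≤ G} |∧²H| in the symmetric case; and Σ_{H ≤ G} |Sym²H| in the alternating case, where the sums range over all subgroups H of G. -/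
open Filter
open scoped Topology TensorProduct

/-- The finite abelian `p`-group `ℤ/p^{d₁} × ⋯ × ℤ/p^{d_r}`. -/
abbrev PGrp (p : ℕ) {r : ℕ} (dd : Fin r → ℕ) : Type := (i : Fin r) → ZMod (p ^ dd i)

/-- The standard `R`-bilinear pairing `g · h = Σ_i p^{d - d_i} g_i h_i ∈ ℤ/p^d`. -/
def dotPairing (p d : ℕ) {r : ℕ} (dd : Fin r → ℕ) (g h : PGrp p dd) : ZMod (p ^ d) :=
  ∑ i : Fin r,
    (p : ZMod (p ^ d)) ^ (d - dd i) * ((g i).val : ZMod (p ^ d)) * ((h i).val : ZMod (p ^ d))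

/-- The exterior square `∧² G`. -/
abbrev exteriorSquare (G : Type) [AddCommGroup G] : Type :=
  (G ⊗[ℤ] G) ⧸ Submodule.span ℤ {x : G ⊗[ℤ] G | ∃ g : G, x = g ⊗ₜ[ℤ] g}

/-- The symmetric square `Sym² G`. -/
abbrev symmetricSquare (G : Type) [AddCommGroup G] : Type :=
  (G ⊗[ℤ] G) ⧸ Submodule.span ℤ
    {x : G ⊗[ℤ] G | ∃ g₁ g₂ : G, x = g₁ ⊗ₜ[ℤ] g₂ - g₂ ⊗ₜ[ℤ] g₁}

section Duality

variable {N : ℕ} [NeZero N]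

instance hasEnoughRootsOfUnity_multiplicative_zmod :
    HasEnoughRootsOfUnity (Multiplicative (ZMod N)) N where
  prim := ⟨Multiplicative.ofAdd 1, by
    have h : orderOf (Multiplicative.ofAdd (1 : ZMod N)) = N := by
      rw [orderOf_ofAdd_eq_addOrderOf, ZMod.addOrderOf_one]
    simpa only [h] using IsPrimitiveRoot.orderOf (Multiplicative.ofAdd (1 : ZMod N))⟩
  cyc := by
    have : IsCyclic (Multiplicative (ZMod N))ˣ :=
      isCyclic_of_surjective (toUnits (G := Multiplicative (ZMod N))) toUnits.surjective
    infer_instance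

/-- A finite abelian group killed by `N` has as many elements as its `ℤ/N`-dual. -/
theorem card_addMonoidHom_zmod (A : Type*) [AddCommGroup A] [Finite A]
    (hA : ∀ a : A, N • a = 0) : Nat.card (A →+ ZMod N) = Nat.card A := by
  have hexp : Monoid.exponent (Multiplicative A) ∣ N :=
    Monoid.exponent_dvd_of_forall_pow_eq_one fun a => hA a.toAdd
  have : HasEnoughRootsOfUnity (Multiplicative (ZMod N)) (Monoid.exponent (Multiplicative A)) :=
    HasEnoughRootsOfUnity.of_dvd _ hexp
  have h := CommGroup.card_monoidHom_of_hasEnoughRootsOfUnity (Multiplicative A)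
    (Multiplicative (ZMod N))
  rw [Nat.card_congr Multiplicative.toAdd] at h
  rw [← h, Nat.card_congr AddMonoidHom.toMultiplicative]
  exact Nat.card_congr (MulEquiv.monoidHomCongrRight toUnits).toEquiv

variable {G : Type*} [AddCommGroup G] [Finite G]

/-- Restriction to `H` of the functionals `φ h`. -/
def restrictedPairing (φ : G →+ G →+ ZMod N) (H : AddSubgroup G) : G →+ H →+ ZMod N :=
  (AddMonoidHom.compHom' H.subtype).comp φ

variable (hG : ∀ a : G, N • a = 0) {φ : G →+ G →+ ZMod N} (hφ : Function.Injective φ)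
  (H : AddSubgroup G)

include hG in
theorem card_dual_subgroup : Nat.card (H →+ ZMod N) = Nat.card H :=
  card_addMonoidHom_zmod H fun a => Subtype.ext (by simpa using hG a)

include hG hφ in
theorem card_ker_restrictedPairing_le :
    Nat.card (restrictedPairing φ H).ker ≤ Nat.card (G ⧸ H) := by
  have hQ : Nat.card ((G ⧸ H) →+ ZMod N) = Nat.card (G ⧸ H) :=
    card_addMonoidHom_zmod (G ⧸ H) fun a => by
      induction a using QuotientAddGroup.induction_on with
      | H z => rw [← QuotientAddGroup.mk_nsmul, hG, QuotientAddGroup.mk_zero]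
  have : Finite ((G ⧸ H) →+ ZMod N) := DFunLike.finite _
  rw [← hQ]
  refine Nat.card_le_card_of_injective (fun h : (restrictedPairing φ H).ker =>
    QuotientAddGroup.lift H (φ h) fun x hx => ?_) fun a b hab => ?_
  · exact DFunLike.congr_fun (AddMonoidHom.mem_ker.1 h.2) (⟨x, hx⟩ : H)
  · refine Subtype.ext (hφ (AddMonoidHom.ext fun x => ?_))
    exact DFunLike.congr_fun hab (QuotientAddGroup.mk x)

include hG hφ in
theorem restrictedPairing_surjective : Function.Surjective (restrictedPairing φ H) := by
  have : Finite (H →+ ZMod N) := DFunLike.finite _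
  refine AddMonoidHom.surjective_of_card_ker_le_div _ ?_
  rw [card_dual_subgroup hG, H.card_eq_card_quotient_mul_card_addSubgroup,
    Nat.mul_div_cancel _ Nat.card_pos]
  exact card_ker_restrictedPairing_le hG hφ H

include hG hφ in
theorem card_ker_restrictedPairing_mul :
    Nat.card (restrictedPairing φ H).ker * Nat.card H = Nat.card G := by
  rw [(restrictedPairing φ H).ker.card_eq_card_quotient_mul_card_addSubgroup,
    Nat.card_congr (QuotientAddGroup.quotientKerEquivOfSurjective _
      (restrictedPairing_surjective hG hφ H)).toEquiv, card_dual_subgroup hG, mul_comm]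

end Duality

/-- Counting tuples through a surjective homomorphism. -/
theorem card_subtype_comp {A B : Type*} [AddCommGroup A] [AddCommGroup B] (f : A →+ B)
    (hf : Function.Surjective f) (n : ℕ) (P : (Fin n → B) → Prop) :
    Nat.card {h : Fin n → A // P fun k => f (h k)} =
      Nat.card {β : Fin n → B // P β} * Nat.card f.ker ^ n := by
  have hs := Function.surjInv_eq hf
  let e : {h : Fin n → A // P fun k => f (h k)} ≃ {β : Fin n → B // P β} × (Fin n → f.ker) :=
    { toFun := fun h => (⟨fun k => f (h.1 k), h.2⟩, fun k =>
        ⟨h.1 k - Function.surjInv hf (f (h.1 k)), by simp [AddMonoidHom.mem_ker, hs]⟩)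
      invFun := fun b => ⟨fun k => Function.surjInv hf (b.1.1 k) + b.2 k, by
        have h : ∀ k, f (b.2 k) = 0 := fun k => (b.2 k).2
        simpa [hs, h] using b.1.2⟩
      left_inv := fun h => by ext; simp
      right_inv := fun b => by
        have h : ∀ k, f (b.2 k) = 0 := fun k => (b.2 k).2
        ext <;> simp [hs, h] }
  rw [Nat.card_congr e, Nat.card_prod, Nat.card_fun, Nat.card_eq_fintype_card (α := Fin n),
    Fintype.card_fin]

section Limit

variable {G : Type*} [AddCommGroup G] [Finite G]

/-- The number of `n`-tuples generating exactly the subgroup `H`. -/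
noncomputable def generatingCount (H : AddSubgroup G) (n : ℕ) : ℕ :=
  Nat.card {g : Fin n → G // AddSubgroup.closure (Set.range g) = H}

/-- The `n`-tuples with entries in `H`, as tuples in `G` generating a subgroup of `H`. -/
def tuplesInSubgroupEquiv (H : AddSubgroup G) (n : ℕ) :
    {g : Fin n → G // AddSubgroup.closure (Set.range g) ≤ H} ≃ (Fin n → H) where
  toFun g k := ⟨g.1 k, g.2 (AddSubgroup.subset_closure ⟨k, rfl⟩)⟩
  invFun g := ⟨fun k => g k, by
    rw [AddSubgroup.closure_le]
    rintro _ ⟨k, rfl⟩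
    exact (g k).2⟩
  left_inv _ := rfl
  right_inv _ := rfl

omit [Finite G] in
theorem card_tuplesInSubgroup (H : AddSubgroup G) (n : ℕ) :
    Nat.card {g : Fin n → G // AddSubgroup.closure (Set.range g) ≤ H} = Nat.card H ^ n := by
  rw [Nat.card_congr (tuplesInSubgroupEquiv H n), Nat.card_fun,
    Nat.card_eq_fintype_card (α := Fin n), Fintype.card_fin]

theorem generatingCount_le (H : AddSubgroup G) (n : ℕ) :
    generatingCount H n ≤ Nat.card H ^ n := by
  rw [← card_tuplesInSubgroup]
  exact Nat.card_le_card_of_injective (Subtype.impEmbedding _ _ fun _ h => h.le)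
    (Function.Embedding.injective _)

open scoped Classical in
theorem sum_generatingCount [Fintype (AddSubgroup G)] (H : AddSubgroup G) (n : ℕ) :
    ∑ K : AddSubgroup G with K ≤ H, generatingCount K n = Nat.card H ^ n := by
  rw [← card_tuplesInSubgroup, Finset.sum_subtype (p := fun K => K ≤ H) _ (by simp)]
  simp only [generatingCount]
  rw [← Nat.card_sigma]
  exact Nat.card_congr
    { toFun := fun x => ⟨x.2.1, x.2.2.le.trans x.1.2⟩
      invFun := fun g => ⟨⟨_, g.2⟩, g.1, rfl⟩
      left_inv := by
        rintro ⟨⟨K, hK⟩, g, hg⟩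
        obtain rfl : AddSubgroup.closure (Set.range g) = K := hg
        rfl
      right_inv := fun _ => rfl }

/-- Almost all tuples of elements of `H` generate `H`. -/
theorem tendsto_generatingCount_div (H : AddSubgroup G) :
    Tendsto (fun n => (generatingCount H n : ℝ) / (Nat.card H : ℝ) ^ n) atTop (𝓝 1) := by
  classical
  have := Fintype.ofFinite (AddSubgroup G)
  have hpos : (0 : ℝ) < Nat.card H := Nat.cast_pos.2 Nat.card_pos
  have hlt : ∀ K : AddSubgroup G, K < H →
      Tendsto (fun n => (generatingCount K n : ℝ) / (Nat.card H : ℝ) ^ n) atTop (𝓝 0) := by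
    intro K hK
    have hcard : (Nat.card K : ℝ) < Nat.card H := by
      exact_mod_cast Set.Finite.card_lt_card (Set.toFinite (H : Set G)) hK
    refine squeeze_zero (fun n => by positivity) (fun n => ?_)
      (tendsto_pow_atTop_nhds_zero_of_lt_one (r := (Nat.card K : ℝ) / Nat.card H)
        (by positivity) ((div_lt_one hpos).2 hcard))
    rw [div_pow]
    gcongr
    exact_mod_cast generatingCount_le K n
  have hsum : ∀ n, (generatingCount H n : ℝ) / (Nat.card H : ℝ) ^ n =
      1 - ∑ K : AddSubgroup G with K < H, (generatingCount K n : ℝ) / (Nat.card H : ℝ) ^ n := by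
    intro n
    have h := sum_generatingCount H n
    have hins : (Finset.univ.filter fun K : AddSubgroup G => K ≤ H) =
        insert H (Finset.univ.filter fun K : AddSubgroup G => K < H) := by
      ext K; simp [le_iff_eq_or_lt]
    rw [hins, Finset.sum_insert (by simp)] at h
    have h' : (generatingCount H n : ℝ) +
        ∑ K : AddSubgroup G with K < H, (generatingCount K n : ℝ) = (Nat.card H : ℝ) ^ n := by
      exact_mod_cast h
    rw [← Finset.sum_div, eq_sub_iff_add_eq, ← add_div, h', div_self (by positivity)]
  simp_rw [hsum]
  simpa using (tendsto_const_nhds (x := (1 : ℝ))).sub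
    (tendsto_finsetSum (Finset.univ.filter fun K : AddSubgroup G => K < H)
      fun K hK => hlt K (by simpa using hK))

/-- If the number of `h` compatible with `g` is `C ⟨g⟩ (|G|/|⟨g⟩|)ⁿ`, then the number of compatible
pairs is asymptotic to `(∑ C H) |G|ⁿ`. -/
theorem tendsto_card_pairs_div (P : ∀ n : ℕ, (Fin n → G) → (Fin n → G) → Prop)
    (C : AddSubgroup G → ℕ)
    (hP : ∀ n (g : Fin n → G), (Nat.card {h : Fin n → G // P n g h} : ℝ) =
      C (AddSubgroup.closure (Set.range g)) *
        ((Nat.card G : ℝ) / Nat.card (AddSubgroup.closure (Set.range g))) ^ n) :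
    Tendsto (fun n : ℕ => (Nat.card {v : Fin n → G × G //
        P n (fun k => (v k).1) (fun k => (v k).2)} : ℝ) / (Nat.card G : ℝ) ^ n) atTop
      (𝓝 (∑' H : AddSubgroup G, (C H : ℝ))) := by
  classical
  have := Fintype.ofFinite (AddSubgroup G)
  have := Fintype.ofFinite G
  have hpos : (0 : ℝ) < Nat.card G := Nat.cast_pos.2 Nat.card_pos
  have key : ∀ n, (Nat.card {v : Fin n → G × G //
        P n (fun k => (v k).1) (fun k => (v k).2)} : ℝ) / (Nat.card G : ℝ) ^ n =
      ∑ H : AddSubgroup G, (C H : ℝ) * ((generatingCount H n : ℝ) / (Nat.card H : ℝ) ^ n) := by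
    intro n
    let e : {v : Fin n → G × G // P n (fun k => (v k).1) (fun k => (v k).2)} ≃
        Σ g : Fin n → G, {h : Fin n → G // P n g h} :=
      { toFun := fun v => ⟨fun k => (v.1 k).1, fun k => (v.1 k).2, v.2⟩
        invFun := fun x => ⟨fun k => (x.1 k, x.2.1 k), x.2.2⟩
        left_inv := fun _ => rfl
        right_inv := fun _ => rfl }
    rw [Nat.card_congr e, Nat.card_sigma, Nat.cast_sum, Finset.sum_div,
      ← Finset.sum_fiberwise Finset.univ fun g : Fin n → G => AddSubgroup.closure (Set.range g)]
    refine Finset.sum_congr rfl fun H _ => ?_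
    have hH : (0 : ℝ) < Nat.card H := Nat.cast_pos.2 Nat.card_pos
    rw [Finset.sum_congr rfl (g := fun _ => (C H : ℝ) / (Nat.card H : ℝ) ^ n), Finset.sum_const,
      nsmul_eq_mul]
    · rw [generatingCount, Nat.card_eq_fintype_card (α := {g : Fin n → G // _}),
        Fintype.card_subtype]
      ring
    · intro g hg
      rw [hP, (Finset.mem_filter.1 hg).2, div_pow]
      field_simp
  simp_rw [key]
  rw [tsum_fintype]
  simpa using tendsto_finsetSum Finset.univ fun H _ =>
    (tendsto_generatingCount_div H).const_mul (C H : ℝ)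

end Limit

section Bilinear

variable {H R : Type*} [AddCommGroup H] [AddCommGroup R] {n : ℕ} {g : Fin n → H}

theorem bilinear_ext (hg : AddSubgroup.closure (Set.range g) = ⊤) {f₁ f₂ : H →+ R}
    (h : ∀ k, f₁ (g k) = f₂ (g k)) : f₁ = f₂ := by
  refine AddMonoidHom.eq_of_eqOn_dense hg ?_
  rintro _ ⟨k, rfl⟩
  exact h k

/-- A family of functionals `β l` with `β l (g k) = ε β k (g l)` comes from a bilinear form. -/
theorem exists_bilinear (hg : AddSubgroup.closure (Set.range g) = ⊤) (ε : ℤ)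
    (β : Fin n → H →+ R) (hβ : ∀ k l, β l (g k) = ε • β k (g l)) :
    ∃ B : H →+ H →+ R, ∀ l, B (g l) = β l := by
  classical
  let π : (Fin n → ℤ) →+ H := (Fintype.linearCombination ℤ g).toAddMonoidHom
  let b : (Fin n → ℤ) →+ H →+ R := (Fintype.linearCombination ℤ β).toAddMonoidHom
  have hπ1 : ∀ l, π (Pi.single l 1) = g l := fun l => by simp [π]
  have hb1 : ∀ l, b (Pi.single l 1) = β l := fun l => by simp [b]
  have hπ : Function.Surjective π := by
    rw [← AddMonoidHom.range_eq_top, eq_top_iff, ← hg, AddSubgroup.closure_le]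
    rintro _ ⟨l, rfl⟩
    exact ⟨_, hπ1 l⟩
  have hker : π.ker ≤ b.ker := by
    intro c hc
    have hc' : ∑ l, c l • g l = 0 := hc
    refine bilinear_ext hg fun k => ?_
    have : b c (g k) = ε • β k (∑ l, c l • g l) := by
      simp only [b, LinearMap.toAddMonoidHom_coe, Fintype.linearCombination_apply,
        AddMonoidHom.finsetSum_apply, AddMonoidHom.coe_smul, Pi.smul_apply, map_sum,
        map_zsmul, Finset.smul_sum]
      exact Finset.sum_congr rfl fun l _ => by rw [hβ, smul_comm]
    rw [this, hc', map_zero, smul_zero]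
    rfl
  refine ⟨AddMonoidHom.liftOfSurjective π hπ ⟨b, hker⟩, fun l => ?_⟩
  rw [← hπ1, ← hb1]
  exact AddMonoidHom.liftOfRightInverse_comp_apply _ _ _ _ _

theorem bilinear_skew (hg : AddSubgroup.closure (Set.range g) = ⊤) (ε : ℤ)
    (B : H →+ H →+ R) (hB : ∀ k l, B (g l) (g k) = ε • B (g k) (g l)) (x y : H) :
    B x y = ε • B y x := by
  have h1 : ∀ l, B (g l) = ε • B.flip (g l) := fun l => bilinear_ext hg fun k => by
    simpa using hB k l
  have h2 : B = ε • B.flip := bilinear_ext hg fun l => by simpa using h1 l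
  simpa using DFunLike.congr_fun (DFunLike.congr_fun h2 x) y

theorem bilinear_alternating (hg : AddSubgroup.closure (Set.range g) = ⊤)
    (B : H →+ H →+ R) (hB : ∀ k l, B (g l) (g k) = -B (g k) (g l)) (hB0 : ∀ k, B (g k) (g k) = 0)
    (x : H) : B x x = 0 := by
  have hskew : ∀ x y, B x y = -B y x := fun x y => by
    simpa using bilinear_skew hg (-1) B (by simpa using hB) x y
  have hx : x ∈ AddSubgroup.closure (Set.range g) := hg ▸ AddSubgroup.mem_top x
  induction hx using AddSubgroup.closure_induction with
  | mem x hx => obtain ⟨k, rfl⟩ := hx; exact hB0 k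
  | zero => simp
  | add x y _ _ hx hy => simp [hx, hy, hskew x y]
  | neg x _ hx => simp [hx]

/-- Alternating tuples of functionals on generators are alternating forms. -/
theorem card_alternating_tuples (hg : AddSubgroup.closure (Set.range g) = ⊤) :
    Nat.card {β : Fin n → H →+ R // (∀ k, β k (g k) = 0) ∧
      ∀ k l, k < l → β l (g k) + β k (g l) = 0} =
    Nat.card {B : H →+ H →+ R // ∀ x, B x x = 0} := by
  symm
  refine Nat.card_congr (Equiv.ofBijective (fun B => ⟨fun l => B.1 (g l), fun k => B.2 _,
    fun k l _ => ?_⟩) ⟨fun B B' h => ?_, fun β => ?_⟩)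
  · have h := B.2 (g l + g k)
    simpa [B.2] using h
  · exact Subtype.ext (bilinear_ext hg fun l => congr_fun (congr_arg Subtype.val h) l)
  · have hβ : ∀ k l, β.1 l (g k) = -β.1 k (g l) := by
      intro k l
      rcases lt_trichotomy k l with h | rfl | h
      · exact eq_neg_of_add_eq_zero_left (β.2.2 k l h)
      · simp [β.2.1]
      · exact eq_neg_of_add_eq_zero_right (β.2.2 l k h)
    obtain ⟨B, hB⟩ := exists_bilinear hg (-1) β.1 (by simpa using hβ)
    refine ⟨⟨B, bilinear_alternating hg B (fun k l => ?_) fun k => ?_⟩,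
      Subtype.ext (funext hB)⟩
    · simpa [hB] using hβ k l
    · rw [hB]; exact β.2.1 k

/-- Symmetric tuples of functionals on generators are symmetric forms. -/
theorem card_symmetric_tuples (hg : AddSubgroup.closure (Set.range g) = ⊤) :
    Nat.card {β : Fin n → H →+ R // ∀ k l, k < l → β l (g k) - β k (g l) = 0} =
    Nat.card {B : H →+ H →+ R // ∀ x y, B x y = B y x} := by
  symm
  refine Nat.card_congr (Equiv.ofBijective (fun B => ⟨fun l => B.1 (g l),
    fun k l _ => sub_eq_zero.2 (B.2 _ _)⟩) ⟨fun B B' h => ?_, fun β => ?_⟩)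
  · exact Subtype.ext (bilinear_ext hg fun l => congr_fun (congr_arg Subtype.val h) l)
  · have hβ : ∀ k l, β.1 l (g k) = β.1 k (g l) := by
      intro k l
      rcases lt_trichotomy k l with h | rfl | h
      · exact sub_eq_zero.1 (β.2 k l h)
      · rfl
      · exact (sub_eq_zero.1 (β.2 l k h)).symm
    obtain ⟨B, hB⟩ := exists_bilinear hg 1 β.1 (by simpa using hβ)
    refine ⟨⟨B, fun x y => ?_⟩, Subtype.ext (funext hB)⟩
    simpa using bilinear_skew hg 1 B (by simpa [hB] using hβ) x y

end Bilinear

section Squares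

variable {H R : Type} [AddCommGroup H] [AddCommGroup R]

/-- The linearisation of a bilinear form. -/
def linearisation (B : H →+ H →+ R) : H ⊗[ℤ] H →ₗ[ℤ] R :=
  (TensorProduct.liftAddHom B fun r x y => by simp).toIntLinearMap

@[simp]
theorem linearisation_tmul (B : H →+ H →+ R) (x y : H) : linearisation B (x ⊗ₜ y) = B x y := rfl

/-- The bilinear form attached to a linear map on the tensor square. -/
def bilinearOfLinear (f : H ⊗[ℤ] H →ₗ[ℤ] R) : H →+ H →+ R :=
  AddMonoidHom.mk' (fun x => AddMonoidHom.mk' (fun y => f (x ⊗ₜ y)) fun y z => by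
    rw [TensorProduct.tmul_add, map_add]) fun x z => AddMonoidHom.ext fun y => by
      simp [TensorProduct.add_tmul]

@[simp]
theorem bilinearOfLinear_apply (f : H ⊗[ℤ] H →ₗ[ℤ] R) (x y : H) :
    bilinearOfLinear f x y = f (x ⊗ₜ y) := rfl

theorem linearisation_bilinearOfLinear (f : H ⊗[ℤ] H →ₗ[ℤ] R) :
    linearisation (bilinearOfLinear f) = f :=
  TensorProduct.ext' fun _ _ => rfl

/-- Bilinear forms whose linearisations kill `S` are homomorphisms out of `(H ⊗ H) ⧸ ⟨S⟩`. -/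
def bilinearQuotientEquiv (S : Set (H ⊗[ℤ] H)) :
    {B : H →+ H →+ R // ∀ s ∈ S, linearisation B s = 0} ≃
      (((H ⊗[ℤ] H) ⧸ Submodule.span ℤ S) →+ R) where
  toFun B := ((Submodule.span ℤ S).liftQ (linearisation B.1)
    (Submodule.span_le.2 fun s hs => B.2 s hs)).toAddMonoidHom
  invFun f := ⟨bilinearOfLinear (f.toIntLinearMap.comp (Submodule.span ℤ S).mkQ), fun s hs => by
    have h0 : (Submodule.span ℤ S).mkQ s = 0 := by
      simpa using Submodule.subset_span hs
    rw [linearisation_bilinearOfLinear, LinearMap.comp_apply, h0, map_zero]⟩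
  left_inv B := Subtype.ext <| AddMonoidHom.ext fun x => AddMonoidHom.ext fun y => by simp
  right_inv f := AddMonoidHom.ext fun z => by
    obtain ⟨z, rfl⟩ := Submodule.Quotient.mk_surjective _ z
    simp only [LinearMap.toAddMonoidHom_coe, linearisation_bilinearOfLinear,
      Submodule.liftQ_apply]
    rfl

variable {N : ℕ} (hH : ∀ a : H, N • a = 0)

include hH in
theorem nsmul_tensorSquare (t : H ⊗[ℤ] H) : N • t = 0 := by
  induction t using TensorProduct.induction_on with
  | zero => simp
  | tmul x y => rw [TensorProduct.smul_tmul', hH, TensorProduct.zero_tmul]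
  | add x y hx hy => rw [smul_add, hx, hy, add_zero]

variable [NeZero N] [Finite H]

include hH in
theorem card_dual_tensorSquare_quotient (S : Submodule ℤ (H ⊗[ℤ] H)) :
    Nat.card (((H ⊗[ℤ] H) ⧸ S) →+ ZMod N) = Nat.card ((H ⊗[ℤ] H) ⧸ S) := by
  have : Module.Finite ℤ H := Module.Finite.of_finite
  have : Module.Finite ℤ (H ⊗[ℤ] H) := Module.Finite.tensorProduct ℤ H H
  have : Module.Finite ℤ ((H ⊗[ℤ] H) ⧸ S) := Module.Finite.quotient ℤ S
  have hk : ∀ a : (H ⊗[ℤ] H) ⧸ S, N • a = 0 := fun a => by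
    obtain ⟨a, rfl⟩ := Submodule.Quotient.mk_surjective _ a
    rw [← Submodule.Quotient.mk_smul, nsmul_tensorSquare hH, Submodule.Quotient.mk_zero]
  have : Finite ((H ⊗[ℤ] H) ⧸ S) := Module.finite_of_fg_torsion _ fun a =>
    ⟨⟨(N : ℤ), by simpa using NeZero.ne N⟩, by
      simpa [Submonoid.smul_def] using hk a⟩
  exact card_addMonoidHom_zmod _ hk

include hH in
theorem card_alternating_forms :
    Nat.card {B : H →+ H →+ ZMod N // ∀ x, B x x = 0} = Nat.card (exteriorSquare H) := by
  rw [← card_dual_tensorSquare_quotient hH, ← Nat.card_congr (bilinearQuotientEquiv _)]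
  refine Nat.card_congr (Equiv.subtypeEquivRight fun B => ⟨?_, fun h x => ?_⟩)
  · rintro h _ ⟨x, rfl⟩
    simpa using h x
  · simpa using h _ ⟨x, rfl⟩

include hH in
theorem card_symmetric_forms :
    Nat.card {B : H →+ H →+ ZMod N // ∀ x y, B x y = B y x} = Nat.card (symmetricSquare H) := by
  rw [← card_dual_tensorSquare_quotient hH, ← Nat.card_congr (bilinearQuotientEquiv _)]
  refine Nat.card_congr (Equiv.subtypeEquivRight fun B => ⟨?_, fun h x y => ?_⟩)
  · rintro h _ ⟨x, y, rfl⟩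
    simpa [sub_eq_zero] using h x y
  · simpa [sub_eq_zero] using h _ ⟨x, y, rfl⟩

end Squares

section Pairing

variable {N : ℕ} [NeZero N] {G : Type*} [AddCommGroup G] [Finite G]
  (hG : ∀ a : G, N • a = 0) {φ : G →+ G →+ ZMod N} (hφ : Function.Injective φ)

/-- The tuple `g`, seen in the subgroup it generates. -/
def toClosure {n : ℕ} (g : Fin n → G) (k : Fin n) : AddSubgroup.closure (Set.range g) :=
  ⟨g k, AddSubgroup.subset_closure ⟨k, rfl⟩⟩

omit [Finite G] in
theorem closure_range_toClosure {n : ℕ} (g : Fin n → G) :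
    AddSubgroup.closure (Set.range (toClosure g)) = ⊤ := by
  rw [← AddSubgroup.closure_closure_coe_preimage (k := Set.range g)]
  congr 1
  ext ⟨x, hx⟩
  simp [toClosure]

include hG hφ in
theorem card_of_restrictedPairing {n : ℕ} (H : AddSubgroup G)
    (P : (Fin n → H →+ ZMod N) → Prop) :
    (Nat.card {h : Fin n → G // P fun k => restrictedPairing φ H (h k)} : ℝ) =
      (Nat.card {β // P β} : ℕ) * ((Nat.card G : ℝ) / Nat.card H) ^ n := by
  have hH : (Nat.card H : ℝ) ≠ 0 := Nat.cast_ne_zero.2 Nat.card_pos.ne'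
  rw [card_subtype_comp _ (restrictedPairing_surjective hG hφ H),
    ← card_ker_restrictedPairing_mul hG hφ H]
  push_cast
  rw [mul_div_cancel_right₀ _ hH]

end Pairing

section DotPairing

variable {p d r : ℕ} {dd : Fin r → ℕ}

theorem pow_sub_mul_natCast_congr {e a b : ℕ} (he : e ≤ d) (h : a ≡ b [MOD p ^ e]) :
    (p : ZMod (p ^ d)) ^ (d - e) * (a : ZMod (p ^ d)) =
      (p : ZMod (p ^ d)) ^ (d - e) * (b : ZMod (p ^ d)) := by
  have h' := h.mul_left' (p ^ (d - e))
  rw [← pow_add, Nat.sub_add_cancel he] at h'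
  exact_mod_cast (ZMod.natCast_eq_natCast_iff _ _ _).2 h'

theorem dotPairing_comm (g h : PGrp p dd) : dotPairing p d dd g h = dotPairing p d dd h g :=
  Finset.sum_congr rfl fun _ _ => mul_right_comm _ _ _

variable [Fact p.Prime]

theorem dotPairing_add_left (hdd : ∀ i, dd i ≤ d) (g g' h : PGrp p dd) :
    dotPairing p d dd (g + g') h = dotPairing p d dd g h + dotPairing p d dd g' h := by
  have : ∀ i, NeZero (p ^ dd i) := fun i => ⟨pow_ne_zero _ (Fact.out : p.Prime).ne_zero⟩
  simp only [dotPairing, ← Finset.sum_add_distrib]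
  refine Finset.sum_congr rfl fun i _ => ?_
  have hv : ((g + g') i).val ≡ (g i).val + (g' i).val [MOD p ^ dd i] := by
    rw [Pi.add_apply, ZMod.val_add]
    exact Nat.mod_modEq _ _
  rw [pow_sub_mul_natCast_congr (hdd i) hv]
  push_cast
  ring

/-- The standard pairing as a bihomomorphism, with its arguments exchanged. -/
def dotPairingHom (hdd : ∀ i, dd i ≤ d) : PGrp p dd →+ PGrp p dd →+ ZMod (p ^ d) :=
  AddMonoidHom.mk' (fun h => AddMonoidHom.mk' (fun g => dotPairing p d dd g h)
    fun g g' => dotPairing_add_left hdd g g' h) fun h h' => AddMonoidHom.ext fun g => by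
      change dotPairing p d dd g (h + h') = dotPairing p d dd g h + dotPairing p d dd g h'
      rw [dotPairing_comm, dotPairing_add_left hdd, dotPairing_comm h, dotPairing_comm h']

theorem dotPairingHom_injective (hdd1 : ∀ i, 1 ≤ dd i) (hdd : ∀ i, dd i ≤ d) :
    Function.Injective (dotPairingHom (p := p) hdd) := by
  have hp : p.Prime := Fact.out
  have hne : ∀ i, NeZero (p ^ dd i) := fun i => ⟨pow_ne_zero _ hp.ne_zero⟩
  have hlt : ∀ i, Fact (1 < p ^ dd i) := fun i =>
    ⟨Nat.one_lt_pow (Nat.one_le_iff_ne_zero.1 (hdd1 i)) hp.one_lt⟩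
  rw [injective_iff_map_eq_zero]
  intro h hh
  ext i
  have h1 : dotPairing p d dd (Pi.single i 1) h = 0 := DFunLike.congr_fun hh (Pi.single i 1)
  rw [dotPairing, Finset.sum_eq_single i
    (fun j _ hj => by rw [Pi.single_eq_of_ne hj, ZMod.val_zero]; simp) (by simp), Pi.single_eq_same, ZMod.val_one, Nat.cast_one, mul_one] at h1
  have h2 : p ^ d ∣ p ^ (d - dd i) * (h i).val := by
    rw [← ZMod.natCast_eq_zero_iff]
    exact_mod_cast h1
  rw [← Nat.sub_add_cancel (hdd i), pow_add, Nat.sub_add_cancel (hdd i)] at h2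
  have h3 := Nat.dvd_of_mul_dvd_mul_left (pow_pos hp.pos _) h2
  exact (ZMod.val_eq_zero _).1 (Nat.eq_zero_of_dvd_of_lt h3 (ZMod.val_lt _))

omit [Fact p.Prime] in
theorem pow_nsmul_pGrp (hdd : ∀ i, dd i ≤ d) (a : PGrp p dd) : p ^ d • a = 0 := by
  ext i
  rw [Pi.smul_apply, nsmul_eq_mul, (ZMod.natCast_eq_zero_iff _ _).2 (pow_dvd_pow p (hdd i)),
    zero_mul, Pi.zero_apply]

end DotPairing

/-- limits of `|G_tr| / |G|^n` for the trivial parts of the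
non-symmetric, symmetric and alternating models. -/
theorem trivialPart_limits
    (p d r : ℕ) [Fact p.Prime] (hd : 1 ≤ d) (dd : Fin r → ℕ)
    (hdd1 : ∀ i, 1 ≤ dd i) (hddd : ∀ i, dd i ≤ d) (hanti : Antitone dd) :
    Tendsto (fun n : ℕ =>
        (Nat.card {v : Fin n → PGrp p dd × PGrp p dd //
          ∀ k l : Fin n, dotPairing p d dd (v k).1 (v l).2 = 0} : ℝ) /
          (Nat.card (PGrp p dd) : ℝ) ^ n) atTop
      (𝓝 (Nat.card (AddSubgroup (PGrp p dd)) : ℝ)) ∧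
    Tendsto (fun n : ℕ =>
        (Nat.card {v : Fin n → PGrp p dd × PGrp p dd //
          (∀ k : Fin n, dotPairing p d dd (v k).1 (v k).2 = 0) ∧
          (∀ k l : Fin n, k < l →
            dotPairing p d dd (v k).1 (v l).2 + dotPairing p d dd (v l).1 (v k).2 = 0)} : ℝ) /
          (Nat.card (PGrp p dd) : ℝ) ^ n) atTop
      (𝓝 (∑' H : AddSubgroup (PGrp p dd), (Nat.card (exteriorSquare H) : ℝ))) ∧
    Tendsto (fun n : ℕ =>
        (Nat.card {v : Fin n → PGrp p dd × PGrp p dd //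
          ∀ k l : Fin n, k < l →
            dotPairing p d dd (v k).1 (v l).2 - dotPairing p d dd (v l).1 (v k).2 = 0} : ℝ) /
          (Nat.card (PGrp p dd) : ℝ) ^ n) atTop
      (𝓝 (∑' H : AddSubgroup (PGrp p dd), (Nat.card (symmetricSquare H) : ℝ))) := by
  have hp : p.Prime := Fact.out
  have : ∀ i, NeZero (p ^ dd i) := fun i => ⟨pow_ne_zero _ hp.ne_zero⟩
  have : NeZero (p ^ d) := ⟨pow_ne_zero _ hp.ne_zero⟩
  have hG := pow_nsmul_pGrp (p := p) hddd
  have hφ := dotPairingHom_injective (p := p) hdd1 hddd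
  have hH : ∀ (H : AddSubgroup (PGrp p dd)) (a : H), p ^ d • a = 0 := fun H a =>
    Subtype.ext (hG a)
  have hone : ∑' _ : AddSubgroup (PGrp p dd), ((1 : ℕ) : ℝ) =
      Nat.card (AddSubgroup (PGrp p dd)) := by simp
  refine ⟨?_, ?_, ?_⟩
  · rw [← hone]
    refine tendsto_card_pairs_div
      (fun n g h => ∀ k l : Fin n, dotPairing p d dd (g k) (h l) = 0) (fun _ => 1) fun n g => ?_
    have hg := closure_range_toClosure g
    have h1 : Nat.card {β : Fin n → AddSubgroup.closure (Set.range g) →+ ZMod (p ^ d) //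
        ∀ k l, β l (toClosure g k) = 0} = 1 := by
      rw [Nat.card_eq_one_iff_unique]
      refine ⟨⟨fun β β' => Subtype.ext (funext fun l => bilinear_ext hg fun k => ?_)⟩,
        ⟨⟨0, fun _ _ => rfl⟩⟩⟩
      rw [β.2, β'.2]
    rw [← h1]
    exact card_of_restrictedPairing hG hφ (AddSubgroup.closure (Set.range g))
      fun β => ∀ k l, β l (toClosure g k) = 0
  · refine tendsto_card_pairs_div
      (fun n g h => (∀ k : Fin n, dotPairing p d dd (g k) (h k) = 0) ∧
        ∀ k l : Fin n, k < l →
          dotPairing p d dd (g k) (h l) + dotPairing p d dd (g l) (h k) = 0)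
      (fun H => Nat.card (exteriorSquare H)) fun n g => ?_
    rw [← card_alternating_forms (hH _), ← card_alternating_tuples (closure_range_toClosure g)]
    exact card_of_restrictedPairing hG hφ (AddSubgroup.closure (Set.range g))
      fun β => (∀ k, β k (toClosure g k) = 0) ∧
        ∀ k l, k < l → β l (toClosure g k) + β k (toClosure g l) = 0
  · refine tendsto_card_pairs_div
      (fun n g h => ∀ k l : Fin n, k < l →
        dotPairing p d dd (g k) (h l) - dotPairing p d dd (g l) (h k) = 0)
      (fun H => Nat.card (symmetricSquare H)) fun n g => ?_
    rw [← card_symmetric_forms (hH _), ← card_symmetric_tuples (closure_range_toClosure g)]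
    exact card_of_restrictedPairing hG hφ (AddSubgroup.closure (Set.range g))
      fun β => ∀ k l, k < l → β l (toClosure g k) - β k (toClosure g l) = 0
end

section
/- Let G be a finite abelian group and P: G × G → ℚ/ℤ a perfect bilinear pairing (i.e., the induced map G → Hom(G, ℚ/ℤ) is an isomorphism). Define the bilinear pairing B_Alt on G² = G × G by B_Alt((g,h),(g',h')) = P(g,h') − P(g',h). Then there is a bijection between the set of maximal isotropic subgroups of (G², B_Alt) (equivalently, isotropic subgroups W ≤ G² with |W| = |G|) and the set of pairs (H, β) where H ≤ G is a subgroup and β: H × H → ℚ/ℤ is a symmetric bilinear pairing. In particular, the number of maximal isotropic subgroups of (G², B_Alt) equals Σ_{H ≤ G} |Hom(Sym²H, ℚ/ℤ)|. -/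
open scoped TensorProduct

/-- The group `ℚ/ℤ`. -/
abbrev QmodZ : Type := ℚ ⧸ AddSubgroup.zmultiples (1 : ℚ)

namespace QmodZ

/-- The embedding of `ℚ/ℤ` into `ℝ/ℤ`. -/
noncomputable def toAddCircle : QmodZ →+ AddCircle (1 : ℝ) :=
  QuotientAddGroup.map _ _ (Rat.castHom ℝ).toAddMonoidHom (by
    rw [AddSubgroup.zmultiples_le]
    exact ⟨1, by simp⟩)

theorem toAddCircle_injective : Function.Injective toAddCircle := by
  rw [injective_iff_map_eq_zero]
  intro x
  induction x using QuotientAddGroup.induction_on with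
  | H q =>
    intro h
    have h' : ((q : ℝ) : AddCircle (1 : ℝ)) = 0 := h
    rw [AddCircle.coe_eq_zero_iff] at h'
    obtain ⟨n, hn⟩ := h'
    rw [QuotientAddGroup.eq_zero_iff]
    refine ⟨n, ?_⟩
    simp only [zsmul_eq_mul, mul_one] at hn ⊢
    exact_mod_cast hn

variable (A : Type*) [AddCommGroup A]

/-- A `ℚ/ℤ`-valued character, viewed as a complex additive character. -/
noncomputable def toAddChar (f : A →+ QmodZ) : AddChar A ℂ :=
  Circle.coeHom.compAddChar
    ((AddCircle.toCircle_addChar (T := (1 : ℝ))).compAddMonoidHom (toAddCircle.comp f))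

theorem toAddChar_injective : Function.Injective (toAddChar A) := by
  intro f g h
  ext a
  have h' := DFunLike.congr_fun h a
  exact toAddCircle_injective (AddCircle.injective_toCircle one_ne_zero (Circle.coe_injective h'))

variable [Finite A]

instance : Finite (A →+ QmodZ) := Finite.of_injective _ (toAddChar_injective A)

theorem card_addMonoidHom_le : Nat.card (A →+ QmodZ) ≤ Nat.card A := by
  have := Fintype.ofFinite A
  refine (Nat.card_le_card_of_injective _ (toAddChar_injective A)).trans ?_
  rw [Nat.card_eq_fintype_card, AddChar.card_eq, Nat.card_eq_fintype_card]

theorem card_addMonoidHom : Nat.card (A →+ QmodZ) = Nat.card A := by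
  refine (card_addMonoidHom_le A).antisymm ?_
  refine le_trans ?_ (card_addMonoidHom_le (A →+ QmodZ))
  refine Nat.card_le_card_of_injective (AddMonoidHom.eval : A →+ (A →+ QmodZ) →+ QmodZ) ?_
  rw [injective_iff_map_eq_zero]
  exact fun a ha => CharacterModule.eq_zero_of_character_apply fun c => DFunLike.congr_fun ha c

end QmodZ

section

variable {G : Type*} [AddCommGroup G]

theorem AddMonoidHom.card_ker_mul_card_of_surjective {A B : Type*} [AddCommGroup A]
    [AddCommGroup B] (f : A →+ B) (hf : Function.Surjective f) :
    Nat.card f.ker * Nat.card B = Nat.card A := by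
  rw [f.ker.card_eq_card_quotient_mul_card_addSubgroup, mul_comm,
    Nat.card_congr (QuotientAddGroup.quotientKerEquivOfSurjective f hf).toEquiv]

theorem exists_forall_eq_of_perfect [Finite G] (P : G →+ (G →+ QmodZ))
    (hP : Function.Bijective P) (H : AddSubgroup G) (f : H →+ QmodZ) :
    ∃ h : G, ∀ x : H, P x h = f x := by
  have hinj : Function.Injective P.flip := by
    rw [injective_iff_map_eq_zero]
    intro a ha
    refine CharacterModule.eq_zero_of_character_apply fun c => ?_
    obtain ⟨x, hx⟩ := hP.2 c
    exact (DFunLike.congr_fun hx a).symm.trans (DFunLike.congr_fun ha x)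
  have hbij : Function.Bijective P.flip :=
    (Nat.bijective_iff_injective_and_card _).2 ⟨hinj, (QmodZ.card_addMonoidHom G).symm⟩
  obtain ⟨c, hc⟩ := CharacterModule.dual_surjective_of_injective H.subtype.toIntLinearMap
    H.subtype_injective f
  obtain ⟨h, hh⟩ := hbij.2 c
  exact ⟨h, fun x => (DFunLike.congr_fun hh (x : G)).trans (DFunLike.congr_fun hc x)⟩

/-- The subgroup of `G²` attached to a subgroup `H` and a pairing `β` on `H`: the pairs `(g, h)`
with `g ∈ H` such that `P(·, h)` restricts to `β(·, g)` on `H`. -/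
def graphOfPairing (P : G →+ (G →+ QmodZ)) (H : AddSubgroup G) (β : H →+ (H →+ QmodZ)) :
    AddSubgroup (G × G) where
  carrier := {w | ∃ hw : w.1 ∈ H, ∀ x : H, P x w.2 = β x ⟨w.1, hw⟩}
  zero_mem' := ⟨H.zero_mem, fun x => by
    have h0 : (⟨0, H.zero_mem⟩ : H) = 0 := rfl
    simp [h0]⟩
  add_mem' := by
    rintro w w' ⟨hw, h⟩ ⟨hw', h'⟩
    refine ⟨H.add_mem hw hw', fun x => ?_⟩
    rw [Prod.snd_add, map_add, h, h', ← map_add]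
    rfl
  neg_mem' := by
    rintro w ⟨hw, h⟩
    refine ⟨H.neg_mem hw, fun x => ?_⟩
    rw [Prod.snd_neg, map_neg, h, ← map_neg]
    rfl

theorem mem_graphOfPairing {P : G →+ (G →+ QmodZ)} {H : AddSubgroup G} {β : H →+ (H →+ QmodZ)}
    {w : G × G} :
    w ∈ graphOfPairing P H β ↔ ∃ hw : w.1 ∈ H, ∀ x : H, P x w.2 = β x ⟨w.1, hw⟩ := Iff.rfl

theorem graphOfPairing_isotropic (P : G →+ (G →+ QmodZ)) (H : AddSubgroup G)
    (β : H →+ (H →+ QmodZ)) (hβ : ∀ x y, β x y = β y x) :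
    ∀ w ∈ graphOfPairing P H β, ∀ w' ∈ graphOfPairing P H β,
      P w.1 w'.2 - P w'.1 w.2 = 0 := by
  rintro w ⟨hw, h⟩ w' ⟨hw', h'⟩
  rw [h ⟨w'.1, hw'⟩, h' ⟨w.1, hw⟩, hβ, sub_self]

theorem card_graphOfPairing [Finite G] (P : G →+ (G →+ QmodZ))
    (hP : Function.Bijective P) (H : AddSubgroup G) (β : H →+ (H →+ QmodZ)) :
    Nat.card (graphOfPairing P H β) = Nat.card G := by
  let ψ : H × G →+ (H →+ QmodZ) :=
    ((P.comp H.subtype).flip.comp (AddMonoidHom.snd H G)) -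
      β.flip.comp (AddMonoidHom.fst H G)
  have hψ : Function.Surjective ψ := fun f => by
    obtain ⟨h, hh⟩ := exists_forall_eq_of_perfect P hP H f
    refine ⟨(0, h), ?_⟩
    ext x
    simpa [ψ] using hh x
  have e : graphOfPairing P H β ≃ ψ.ker :=
    { toFun := fun w => ⟨(⟨w.1.1, w.2.1⟩, w.1.2), by
        ext x
        have := w.2.2 x
        simpa [ψ, sub_eq_zero] using this⟩
      invFun := fun v => ⟨(v.1.1, v.1.2), v.1.1.2, fun x => by
        have := DFunLike.congr_fun (AddMonoidHom.mem_ker.1 v.2) x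
        simpa [ψ, sub_eq_zero] using this⟩
      left_inv := fun _ => rfl
      right_inv := fun _ => rfl }
  have h := ψ.card_ker_mul_card_of_surjective hψ
  rw [QmodZ.card_addMonoidHom, Nat.card_prod, mul_comm] at h
  rw [Nat.card_congr e]
  exact Nat.eq_of_mul_eq_mul_left Nat.card_pos h

theorem graphOfPairing_injective [Finite G] (P : G →+ (G →+ QmodZ))
    (hP : Function.Bijective P) {H H' : AddSubgroup G} {β : H →+ (H →+ QmodZ)}
    {β' : H' →+ (H' →+ QmodZ)} (h : graphOfPairing P H β = graphOfPairing P H' β') :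
    (⟨H, β⟩ : (H : AddSubgroup G) × (H →+ (H →+ QmodZ))) = ⟨H', β'⟩ := by
  have key : ∀ {H : AddSubgroup G} (β : H →+ (H →+ QmodZ)) (y : H),
      ∃ k, ((y : G), k) ∈ graphOfPairing P H β := fun {H} β y => by
    obtain ⟨k, hk⟩ := exists_forall_eq_of_perfect P hP H (β.flip y)
    exact ⟨k, y.2, hk⟩
  obtain rfl : H = H' := by
    ext y
    constructor <;> intro hy
    · obtain ⟨k, hk⟩ := key β ⟨y, hy⟩
      exact (h ▸ hk).1
    · obtain ⟨k, hk⟩ := key β' ⟨y, hy⟩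
      exact (h.symm ▸ hk).1
  congr 1
  ext x y
  obtain ⟨k, hk⟩ := key β y
  have hk' : ((y : G), k) ∈ graphOfPairing P H β' := h ▸ hk
  exact (hk.2 x).symm.trans (hk'.2 x)

theorem exists_eq_graphOfPairing [Finite G] (P : G →+ (G →+ QmodZ))
    (hP : Function.Bijective P) (W : AddSubgroup (G × G))
    (hW : ∀ w ∈ W, ∀ w' ∈ W, P w.1 w'.2 - P w'.1 w.2 = 0) (hcard : Nat.card W = Nat.card G) :
    ∃ (H : AddSubgroup G) (β : H →+ (H →+ QmodZ)),
      (∀ x y, β x y = β y x) ∧ graphOfPairing P H β = W := by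
  let H := W.map (AddMonoidHom.fst G G)
  have hex : ∀ y : H, ∃ k, ((y : G), k) ∈ W := by
    rintro ⟨_, w, hw, rfl⟩
    exact ⟨w.2, hw⟩
  choose k hk using hex
  have hval : ∀ (x : H) (w : G × G) (hw : w ∈ W), P x w.2 = P w.1 (k x) := fun x w hw =>
    sub_eq_zero.1 (hW _ (hk x) _ hw)
  have hsymm : ∀ x y : H, P x (k y) = P y (k x) := fun x y => hval x _ (hk y)
  let β : H →+ (H →+ QmodZ) := AddMonoidHom.mk' (fun x => AddMonoidHom.mk' (fun y => P x (k y))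
      fun y y' => by simp only [hsymm x, AddSubgroup.coe_add, map_add, AddMonoidHom.add_apply])
    fun x x' => by ext y; simp
  refine ⟨H, β, hsymm, ?_⟩
  have hle : W ≤ graphOfPairing P H β := fun w hw =>
    ⟨⟨w, hw, rfl⟩, fun x => (hval x w hw).trans (hsymm ⟨w.1, w, hw, rfl⟩ x)⟩
  exact (AddSubgroup.eq_of_le_of_card_ge hle
    ((card_graphOfPairing P hP H β).trans hcard.symm).le).symm

end

/-- Homomorphisms out of `Sym² H` correspond to symmetric bilinear pairings on `H`. -/
noncomputable def symmetricSquareHomEquiv (H : Type) [AddCommGroup H] :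
    (symmetricSquare H →+ QmodZ) ≃ {β : H →+ (H →+ QmodZ) // ∀ x y : H, β x y = β y x} where
  toFun f := ⟨AddMonoidHom.mk' (fun x => AddMonoidHom.mk'
        (fun y => f (Submodule.Quotient.mk (x ⊗ₜ[ℤ] y)))
        fun y y' => by simp only [TensorProduct.tmul_add, Submodule.Quotient.mk_add, map_add])
      fun x x' => by
        ext y
        simp only [TensorProduct.add_tmul, Submodule.Quotient.mk_add, map_add,
          AddMonoidHom.mk'_apply, AddMonoidHom.add_apply],
    fun x y => congrArg f ((Submodule.Quotient.eq _).2 (Submodule.subset_span ⟨x, y, rfl⟩))⟩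
  invFun β := (Submodule.liftQ _
    (TensorProduct.liftAddHom β.1 fun n x y => by simp).toIntLinearMap (by
      rw [Submodule.span_le]
      rintro _ ⟨x, y, rfl⟩
      simp [β.2 x y])).toAddMonoidHom
  left_inv f := by
    ext z
    obtain ⟨z, rfl⟩ := Submodule.Quotient.mk_surjective _ z
    induction z using TensorProduct.induction_on with
    | zero => simp
    | tmul x y => rfl
    | add a b ha hb => rw [Submodule.Quotient.mk_add, map_add, map_add, ha, hb]
  right_inv β := rfl

/-- for a perfect pairing `P : G × G → ℚ/ℤ` on a finite abelian group `G`,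
the maximal isotropic subgroups of `(G², B_Alt)` (equivalently, isotropic subgroups of
cardinality `|G|`) are in bijection with pairs `(H, β)` of a subgroup `H ≤ G` together with
a symmetric bilinear pairing `β : H × H → ℚ/ℤ`; in particular their number is
`Σ_{H ≤ G} |Hom(Sym² H, ℚ/ℤ)|`. -/
theorem maximal_isotropic_BAlt
    (G : Type) [AddCommGroup G] [Fintype G]
    (P : G →+ (G →+ QmodZ)) (hP : Function.Bijective P) :
    Nonempty
      ({W : AddSubgroup (G × G) //
          (∀ w ∈ W, ∀ w' ∈ W,
            P (Prod.fst w) (Prod.snd w') - P (Prod.fst w') (Prod.snd w) = 0) ∧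
          Nat.card W = Nat.card G} ≃
        ((H : AddSubgroup G) ×
          {β : H →+ (H →+ QmodZ) // ∀ x y : H, β x y = β y x})) ∧
    Nat.card {W : AddSubgroup (G × G) //
        (∀ w ∈ W, ∀ w' ∈ W,
          P (Prod.fst w) (Prod.snd w') - P (Prod.fst w') (Prod.snd w) = 0) ∧
        Nat.card W = Nat.card G} =
      Nat.card ((H : AddSubgroup G) × (symmetricSquare H →+ QmodZ)) := by
  classical
  let F : ((H : AddSubgroup G) × {β : H →+ (H →+ QmodZ) // ∀ x y : H, β x y = β y x}) →
      {W : AddSubgroup (G × G) //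
        (∀ w ∈ W, ∀ w' ∈ W,
          P (Prod.fst w) (Prod.snd w') - P (Prod.fst w') (Prod.snd w) = 0) ∧
        Nat.card W = Nat.card G} := fun p =>
    ⟨graphOfPairing P p.1 p.2.1, graphOfPairing_isotropic P p.1 p.2.1 p.2.2,
      card_graphOfPairing P hP p.1 p.2.1⟩
  have hF : Function.Bijective F := by
    constructor
    · rintro ⟨H, β, hβ⟩ ⟨H', β', hβ'⟩ h
      cases graphOfPairing_injective P hP (congrArg Subtype.val h)
      rfl
    · rintro ⟨W, hW, hcard⟩
      obtain ⟨H, β, hβ, rfl⟩ := exists_eq_graphOfPairing P hP W hW hcard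
      exact ⟨⟨H, β, hβ⟩, rfl⟩
  let e := (Equiv.ofBijective F hF).symm
  exact ⟨⟨e⟩, Nat.card_congr
    (e.trans (Equiv.sigmaCongrRight fun H => (symmetricSquareHomEquiv H).symm))⟩
end

section
/- Let p be a prime, d ≥ 1, R = ℤ/p^dℤ, ζ = exp(2πi/p^d) ∈ ℂ, and α ∈ (0, 1/2). Let I and J be finite sets and b_{i,j} ∈ R for all i ∈ I, j ∈ J. Suppose (x_j)_{j ∈ J} are random elements of R, each α-balanced, i.e., P(x_j ≡ a mod p) ≤ 1 − α for every a ∈ F_p. Then |Σ_{i∈I} Π_{j∈J} E(ζ^{b_{i,j} x_j})| ≤ Σ_{i∈I} Π_{j∈J} |1 − α + α ζ^{b_{i,j} t_j}| for some choice of units t_j ∈ R^× (one for each j ∈ J). In particular, the left side is at most max over all (t_j)_{j∈J} ∈ (R^×)^J of the right side. -/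
open MeasureTheory

instance (n : ℕ) : MeasurableSpace (ZMod n) := ⊤

/-- `ζ^r` for `ζ = exp(2πi/m)` and `r ∈ ℤ/mℤ`. -/
noncomputable def zetaPow (m : ℕ) (r : ZMod m) : ℂ :=
  Complex.exp (2 * Real.pi * Complex.I * (r.val : ℂ) / (m : ℂ))

theorem zetaPow_eq_stdAddChar (m : ℕ) [NeZero m] (r : ZMod m) :
    zetaPow m r = ZMod.stdAddChar r := by
  rw [ZMod.stdAddChar_apply, ZMod.toCircle_apply, zetaPow]

theorem norm_zetaPow (m : ℕ) [NeZero m] (r : ZMod m) : ‖zetaPow m r‖ = 1 := by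
  rw [zetaPow_eq_stdAddChar, ZMod.stdAddChar_apply, Circle.norm_coe]

theorem zetaPow_add (m : ℕ) [NeZero m] (r s : ZMod m) :
    zetaPow m (r + s) = zetaPow m r * zetaPow m s := by
  simp only [zetaPow_eq_stdAddChar, AddChar.map_add_eq_mul]

/-- An element of `ℤ/p^dℤ` that does not vanish modulo `p` is a unit. -/
theorem isUnit_of_castHom_ne_zero {p d : ℕ} [Fact p.Prime] (h : p ∣ p ^ d)
    {r : ZMod (p ^ d)} (hr : ZMod.castHom h (ZMod p) r ≠ 0) : IsUnit r := by
  have hp : p.Prime := Fact.out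
  have : NeZero (p ^ d) := ⟨pow_ne_zero _ hp.ne_zero⟩
  rw [← ZMod.natCast_zmod_val r] at hr ⊢
  rw [map_natCast, Ne, ZMod.natCast_eq_zero_iff] at hr
  rw [ZMod.isUnit_iff_coprime]
  exact Nat.Coprime.pow_right _ ((hp.coprime_iff_not_dvd.2 hr).symm)

/-- A real function of a balanced random element `x` has expectation at most
`(1 - α) g r + α g s`, where `r` maximises `g` and `s` maximises `g` off the fibre of `r`. -/
theorem exists_integral_le_of_balanced {R F Ω : Type*} [Finite R] [MeasurableSpace R]
    [DiscreteMeasurableSpace R] [MeasurableSpace Ω] (μ : Measure Ω) [IsProbabilityMeasure μ]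
    (π : R → F) (hπ : ∀ r, ∃ s, π s ≠ π r) (x : Ω → R) (hx : Measurable x) (α : ℝ)
    (hα : α ≤ 1) (hbal : ∀ a, μ {ω | π (x ω) = a} ≤ ENNReal.ofReal (1 - α))
    [Nonempty R] (g : R → ℝ) :
    ∃ r s, π s ≠ π r ∧ ∫ ω, g (x ω) ∂μ ≤ (1 - α) * g r + α * g s := by
  obtain ⟨r, hr⟩ := Finite.exists_max g
  have : Nonempty {s // π s ≠ π r} := nonempty_subtype.2 (hπ r)
  obtain ⟨⟨s, hs⟩, hmax⟩ := Finite.exists_max fun s : {s // π s ≠ π r} ↦ g s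
  refine ⟨r, s, hs, ?_⟩
  set A : Set Ω := {ω | π (x ω) = π r}
  have hA : MeasurableSet A := hx (MeasurableSet.of_discrete (s := {y | π y = π r}))
  have hμA : μ.real A ≤ 1 - α :=
    ENNReal.toReal_le_of_le_ofReal (sub_nonneg.2 hα) (hbal (π r))
  have hind : Integrable (A.indicator fun _ ↦ g r - g s) μ :=
    (integrable_const _).indicator hA
  have hint : Integrable (fun ω ↦ g (x ω)) μ :=
    (Integrable.of_finite (f := g) (μ := μ.map x)).comp_measurable hx
  calc ∫ ω, g (x ω) ∂μ
      ≤ ∫ ω, (A.indicator (fun _ ↦ g r - g s) ω + g s) ∂μ := by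
        refine integral_mono hint (hind.add (integrable_const _)) fun ω ↦ ?_
        by_cases hω : ω ∈ A
        · simpa [hω] using hr (x ω)
        · simpa [hω] using hmax ⟨x ω, hω⟩
    _ = μ.real A * (g r - g s) + g s := by
        rw [integral_add hind (integrable_const _), integral_indicator_const _ hA]
        simp
    _ ≤ (1 - α) * (g r - g s) + g s := by
        gcongr
        exact sub_nonneg.2 (hr s)
    _ = (1 - α) * g r + α * g s := by ring

/-- The complex-valued version of `exists_integral_le_of_balanced`. -/
theorem exists_norm_integral_le_of_balanced {R F Ω : Type*} [Finite R] [MeasurableSpace R]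
    [DiscreteMeasurableSpace R] [MeasurableSpace Ω] (μ : Measure Ω) [IsProbabilityMeasure μ]
    (π : R → F) (hπ : ∀ r, ∃ s, π s ≠ π r) (x : Ω → R) (hx : Measurable x) (α : ℝ)
    (hα : α ≤ 1) (hbal : ∀ a, μ {ω | π (x ω) = a} ≤ ENNReal.ofReal (1 - α))
    [Nonempty R] (h : R → ℂ) :
    ∃ r s, π s ≠ π r ∧ ‖∫ ω, h (x ω) ∂μ‖ ≤ ‖(1 - α : ℂ) * h r + α * h s‖ := by
  obtain ⟨u, hu, hnorm⟩ := RCLike.exists_norm_eq_mul_self (∫ ω, h (x ω) ∂μ)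
  obtain ⟨r, s, hs, hle⟩ :=
    exists_integral_le_of_balanced μ π hπ x hx α hα hbal fun y ↦ (u * h y).re
  have hint : Integrable (fun ω ↦ u * h (x ω)) μ :=
    (Integrable.of_finite (f := fun y ↦ u * h y) (μ := μ.map x)).comp_measurable hx
  refine ⟨r, s, hs, ?_⟩
  calc ‖∫ ω, h (x ω) ∂μ‖ = (∫ ω, u * h (x ω) ∂μ).re := by
        rw [integral_const_mul]
        exact congrArg Complex.re hnorm
    _ = ∫ ω, (u * h (x ω)).re ∂μ := (integral_re hint).symm
    _ ≤ (1 - α) * (u * h r).re + α * (u * h s).re := hle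
    _ = (u * ((1 - α : ℂ) * h r + α * h s)).re := by
        simp
        ring
    _ ≤ ‖u * ((1 - α : ℂ) * h r + α * h s)‖ := Complex.re_le_norm _
    _ = ‖(1 - α : ℂ) * h r + α * h s‖ := by rw [norm_mul, hu, one_mul]

/-- Replacing the factors of a sum of products one at a time. -/
theorem exists_norm_sum_prod_le {I J T : Type*} [Fintype I] [Nonempty T] (e : I → J → ℂ)
    (v : T → I → J → ℂ)
    (h : ∀ j, ∀ c : I → ℂ, ∃ t, ‖∑ i, c i * e i j‖ ≤ ‖∑ i, c i * v t i j‖)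
    (S : Finset J) (c : I → ℂ) :
    ∃ t : J → T, ‖∑ i, c i * ∏ j ∈ S, e i j‖ ≤ ‖∑ i, c i * ∏ j ∈ S, v (t j) i j‖ := by
  classical
  induction S using Finset.induction_on generalizing c with
  | empty => exact ⟨fun _ ↦ Classical.arbitrary T, by simp⟩
  | insert a S ha ih =>
    obtain ⟨τ, hτ⟩ := h a fun i ↦ c i * ∏ j ∈ S, e i j
    obtain ⟨t, ht⟩ := ih fun i ↦ c i * v τ i a
    refine ⟨Function.update t a τ, ?_⟩
    have hprod (i : I) : ∏ j ∈ S, v (Function.update t a τ j) i j = ∏ j ∈ S, v (t j) i j :=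
      Finset.prod_congr rfl fun j hj ↦ by
        rw [Function.update_of_ne (ne_of_mem_of_not_mem hj ha)]
    simp only [Finset.prod_insert ha, Function.update_self, hprod]
    calc ‖∑ i, c i * (e i a * ∏ j ∈ S, e i j)‖
        = ‖∑ i, (c i * ∏ j ∈ S, e i j) * e i a‖ := by
          simp only [mul_comm, mul_left_comm]
      _ ≤ ‖∑ i, (c i * ∏ j ∈ S, e i j) * v τ i a‖ := hτ
      _ = ‖∑ i, (c i * v τ i a) * ∏ j ∈ S, e i j‖ := by
          simp only [mul_right_comm]
      _ ≤ ‖∑ i, (c i * v τ i a) * ∏ j ∈ S, v (t j) i j‖ := ht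
      _ = ‖∑ i, c i * (v τ i a * ∏ j ∈ S, v (t j) i j)‖ := by simp only [mul_assoc]

/-- the extreme point lemma.  For `α`-balanced random elements
`x_j` of `R = ℤ/p^dℤ`, the quantity `|Σ_i Π_j E(ζ^{b_{i,j} x_j})|` is bounded by
`Σ_i Π_j |1 - α + α ζ^{b_{i,j} t_j}|` for some choice of units `t_j ∈ R^×`. -/
theorem extreme_point_bound
    (p d : ℕ) [Fact p.Prime] (hd : 1 ≤ d)
    {Ω : Type} [MeasurableSpace Ω] (μ : Measure Ω) [IsProbabilityMeasure μ]
    (I J : Type) [Fintype I] [Fintype J]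
    (b : I → J → ZMod (p ^ d))
    (α : ℝ) (hα : α ∈ Set.Ioo 0 (1 / 2 : ℝ))
    (x : J → Ω → ZMod (p ^ d))
    (hmeas : ∀ j, Measurable (x j))
    (hbal : ∀ j, ∀ a : ZMod p,
      μ {ω | ZMod.castHom (dvd_pow_self p (Nat.one_le_iff_ne_zero.mp hd)) (ZMod p)
          (x j ω) = a} ≤ ENNReal.ofReal (1 - α)) :
    ∃ t : J → (ZMod (p ^ d))ˣ,
      ‖∑ i : I, ∏ j : J, ∫ ω, zetaPow (p ^ d) (b i j * x j ω) ∂μ‖ ≤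
        ∑ i : I, ∏ j : J,
          ‖(1 - α : ℂ) + (α : ℂ) * zetaPow (p ^ d) (b i j * (t j : ZMod (p ^ d)))‖ := by
  have hp : p.Prime := Fact.out
  have : NeZero (p ^ d) := ⟨pow_ne_zero _ hp.ne_zero⟩
  have : DiscreteMeasurableSpace (ZMod (p ^ d)) := ⟨fun _ ↦ trivial⟩
  set π := ZMod.castHom (dvd_pow_self p (Nat.one_le_iff_ne_zero.mp hd)) (ZMod p)
  have hπ (r : ZMod (p ^ d)) : ∃ s, π s ≠ π r := ⟨r + 1, by simp⟩
  obtain ⟨t, ht⟩ := exists_norm_sum_prod_le (T := ZMod (p ^ d) × (ZMod (p ^ d))ˣ)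
    (fun i j ↦ ∫ ω, zetaPow (p ^ d) (b i j * x j ω) ∂μ)
    (fun t i j ↦ zetaPow (p ^ d) (b i j * t.1) *
      ((1 - α : ℂ) + (α : ℂ) * zetaPow (p ^ d) (b i j * (t.2 : ZMod (p ^ d)))))
    (fun j c ↦ by
      obtain ⟨r, s, hs, hle⟩ := exists_norm_integral_le_of_balanced μ π hπ (x j) (hmeas j) α
        (by linarith [hα.2]) (hbal j) fun y ↦ ∑ i, c i * zetaPow (p ^ d) (b i j * y)
      have hu : IsUnit (s - r) := isUnit_of_castHom_ne_zero _ (by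
        rw [map_sub]
        exact sub_ne_zero.2 hs)
      refine ⟨(r, hu.unit), ?_⟩
      convert hle using 2
      · rw [integral_finsetSum]
        · simp only [integral_const_mul]
        · intro i _
          exact (Integrable.of_finite (f := fun y ↦ c i * zetaPow (p ^ d) (b i j * y))
            (μ := μ.map (x j))).comp_measurable (hmeas j)
      · rw [Finset.mul_sum, Finset.mul_sum, ← Finset.sum_add_distrib]
        refine Finset.sum_congr rfl fun i _ ↦ ?_
        have hs' : b i j * s = b i j * r + b i j * (s - r) := by ring
        rw [hs', zetaPow_add, IsUnit.unit_spec]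
        ring) Finset.univ 1
  refine ⟨fun j ↦ (t j).2, ?_⟩
  simp only [Pi.one_apply, one_mul] at ht
  refine ht.trans ((norm_sum_le _ _).trans_eq ?_)
  simp only [norm_prod, norm_mul, norm_zetaPow, one_mul]
end

section
/- Let p be a prime, d ≥ 1, and let c > c₁ > 1 be constants. Set α_n = c·log(n)/n and ζ = exp(2πi/p^d). Then for every nonzero r ∈ ℤ/p^dℤ and all sufficiently large n, |1 − α_n + α_n ζ^r| ≤ 1 − (2c₁·log(n)/n)·sin²(πr/p^d) ≤ 1 − (8c₁/p^{2d})·log(n)/n. -/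
open Filter

/-- `|1 - a + a e^{2iθ}|² = 1 - 4a(1 - a) sin² θ`. -/
theorem norm_sq_one_sub_add_mul_exp (a θ : ℝ) :
    ‖(1 - a : ℂ) + a * Complex.exp ((2 * θ : ℝ) * Complex.I)‖ ^ 2 =
      1 - 4 * a * (1 - a) * Real.sin θ ^ 2 := by
  rw [Complex.sq_norm, Complex.normSq_apply]
  simp only [Complex.add_re, Complex.add_im, Complex.sub_re, Complex.sub_im, Complex.one_re,
    Complex.one_im, Complex.ofReal_re, Complex.ofReal_im, Complex.re_ofReal_mul,
    Complex.im_ofReal_mul, Complex.exp_ofReal_mul_I_re, Complex.exp_ofReal_mul_I_im]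
  rw [Real.sin_two_mul, Real.cos_two_mul, Real.cos_sq']
  linear_combination (4 * a ^ 2 * Real.sin θ ^ 2) * Real.sin_sq_add_cos_sq θ

/-- Jordan's inequality at the nonzero multiples of `π / m`. -/
theorem two_div_le_sin_pi_mul_div {m k : ℕ} (hk : 0 < k) (hkm : k < m) :
    2 / (m : ℝ) ≤ Real.sin (Real.pi * k / m) := by
  have hm : (0 : ℝ) < m := by exact_mod_cast hk.trans hkm
  have hk1 : (1 : ℝ) ≤ k := by exact_mod_cast hk
  have hkm1 : (k : ℝ) + 1 ≤ m := by exact_mod_cast hkm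
  have hπ := Real.pi_pos
  have jordan (j : ℝ) (hj : 1 ≤ j) (hjm : 2 * j ≤ m) :
      2 / (m : ℝ) ≤ Real.sin (Real.pi * j / m) := by
    have h := Real.mul_le_sin (x := Real.pi * j / m) (by positivity)
      (by rw [div_le_div_iff₀ hm two_pos]; nlinarith)
    refine le_trans ?_ h
    rw [show 2 / Real.pi * (Real.pi * j / m) = 2 * j / m by field_simp]
    gcongr
    linarith
  rcases le_total (2 * (k : ℝ)) m with h | h
  · exact jordan k hk1 h
  · have := jordan (m - k) (by linarith) (by linarith)
    rwa [show Real.pi * (m - k) / m = Real.pi - Real.pi * k / m by field_simp,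
      Real.sin_pi_sub] at this

/-- for `α_n = c log n / n` with `c > c₁ > 1` and every nonzero
`r ∈ ℤ/p^dℤ`, eventually
`|1 - α_n + α_n ζ^r| ≤ 1 - (2c₁ log n / n) sin²(πr/p^d) ≤ 1 - (8c₁/p^{2d}) log n / n`. -/
theorem one_sub_alpha_zeta_bound
    (p d : ℕ) [Fact p.Prime] (hd : 1 ≤ d)
    (c c₁ : ℝ) (hc₁ : 1 < c₁) (hcc : c₁ < c)
    (r : ZMod (p ^ d)) (hr : r ≠ 0) :
    ∀ᶠ n : ℕ in atTop,
      ‖(1 - c * Real.log n / n : ℂ) + (c * Real.log n / n : ℂ) * zetaPow (p ^ d) r‖ ≤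
          1 - (2 * c₁ * Real.log n / n) *
            Real.sin (Real.pi * (r.val : ℝ) / (p ^ d : ℝ)) ^ 2 ∧
        1 - (2 * c₁ * Real.log n / n) *
            Real.sin (Real.pi * (r.val : ℝ) / (p ^ d : ℝ)) ^ 2 ≤
          1 - (8 * c₁ / (p : ℝ) ^ (2 * d)) * (Real.log n / n) := by
  have hp : 0 < p ^ d := pow_pos (Fact.out : p.Prime).pos d
  have : NeZero (p ^ d) := ⟨hp.ne'⟩
  have hpR : (0 : ℝ) < (p : ℝ) ^ d := by exact_mod_cast hp
  have hlog : Tendsto (fun n : ℕ => Real.log n / n) atTop (nhds 0) :=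
    Real.isLittleO_log_id_atTop.tendsto_div_nhds_zero.comp tendsto_natCast_atTop_atTop
  have hsin : 2 / (p : ℝ) ^ d ≤ Real.sin (Real.pi * (r.val : ℝ) / (p ^ d : ℝ)) := by
    have := two_div_le_sin_pi_mul_div (Nat.pos_of_ne_zero ((ZMod.val_ne_zero r).mpr hr))
      (ZMod.val_lt r)
    rwa [Nat.cast_pow] at this
  have hζ : zetaPow (p ^ d) r = Complex.exp
      ((2 * (Real.pi * (r.val : ℝ) / (p ^ d : ℝ)) : ℝ) * Complex.I) := by
    unfold zetaPow
    congr 1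
    push_cast
    ring
  set θ := Real.pi * (r.val : ℝ) / (p ^ d : ℝ)
  have hsq : 4 / (p : ℝ) ^ (2 * d) ≤ Real.sin θ ^ 2 := by
    calc 4 / (p : ℝ) ^ (2 * d) = (2 / (p : ℝ) ^ d) ^ 2 := by
          rw [div_pow, ← pow_mul, mul_comm d 2]; norm_num
      _ ≤ _ := by gcongr
  have hc : 0 < c := by linarith
  have hsmall : ∀ᶠ n : ℕ in atTop, Real.log n / n < (c - c₁) / c ^ 2 :=
    hlog.eventually_lt_const (div_pos (by linarith) (by positivity))
  have hsmall' : ∀ᶠ n : ℕ in atTop, Real.log n / n < 1 / (2 * c₁) :=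
    hlog.eventually_lt_const (by positivity)
  filter_upwards [hsmall, hsmall'] with n h1 h2
  have hL : 0 ≤ Real.log n / n := div_nonneg (Real.log_natCast_nonneg n) n.cast_nonneg
  have hcast : (c * Real.log n / n : ℂ) = ((c * (Real.log n / n) : ℝ) : ℂ) := by
    push_cast
    ring
  rw [hcast, hζ, mul_div_assoc (2 * c₁)]
  generalize Real.log n / n = L at *
  rw [lt_div_iff₀ (by positivity)] at h1 h2
  have hs1 := Real.sin_sq_le_one θ
  have hs0 := sq_nonneg (Real.sin θ)
  constructor
  · refine abs_le_of_sq_le_sq' ?_ ?_ |>.2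
    · rw [norm_sq_one_sub_add_mul_exp]
      nlinarith [mul_nonneg (mul_nonneg hL hs0) (sub_nonneg.mpr h1.le),
        sq_nonneg (2 * c₁ * L * Real.sin θ ^ 2)]
    · nlinarith [mul_le_mul_of_nonneg_left hs1 (show 0 ≤ L * (2 * c₁) by positivity)]
  · have := mul_le_mul_of_nonneg_left hsq (show 0 ≤ 2 * c₁ * L by positivity)
    have e : 8 * c₁ / (p : ℝ) ^ (2 * d) * L = 2 * c₁ * L * (4 / (p : ℝ) ^ (2 * d)) := by ring
    linarith
end
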